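/- There is no isometry g of order 2 of the lattice 𝐋 = 3U ⊕ 2E8 ⊕ A2 acting non-trivially on the discriminant group 𝐋^♯ such that the coinvariant sublattice 𝐋_g is negative definite and contains no vector of square -2, no vector of square -4, and no vector v of square -6 with divisibility (v,𝐋) = 3. -/

import Mathlib

open Matrix

/-- Gram matrix of the lattice `𝐋 = 3U ⊕ 2E8 ⊕ A2` (with `E8` negative definite):
three hyperbolic blocks, two copies of the negative definite `E8` Gram matrix,
and the `A2` block `!![-2,1;1,-2]`. -/
def LGram : Matrix (Fin 24) (Fin 24) ℤ :=
  !![0, 1, 0, 0, 0, 0, 0, 0, 0, 0, 0, 0, 0, 0, 0, 0, 0, 0, 0, 0, 0, 0, 0, 0;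
    1, 0, 0, 0, 0, 0, 0, 0, 0, 0, 0, 0, 0, 0, 0, 0, 0, 0, 0, 0, 0, 0, 0, 0;
    0, 0, 0, 1, 0, 0, 0, 0, 0, 0, 0, 0, 0, 0, 0, 0, 0, 0, 0, 0, 0, 0, 0, 0;
    0, 0, 1, 0, 0, 0, 0, 0, 0, 0, 0, 0, 0, 0, 0, 0, 0, 0, 0, 0, 0, 0, 0, 0;
    0, 0, 0, 0, 0, 1, 0, 0, 0, 0, 0, 0, 0, 0, 0, 0, 0, 0, 0, 0, 0, 0, 0, 0;
    0, 0, 0, 0, 1, 0, 0, 0, 0, 0, 0, 0, 0, 0, 0, 0, 0, 0, 0, 0, 0, 0, 0, 0;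
    0, 0, 0, 0, 0, 0, -2, 0, 1, 0, 0, 0, 0, 0, 0, 0, 0, 0, 0, 0, 0, 0, 0, 0;
    0, 0, 0, 0, 0, 0, 0, -2, 0, 1, 0, 0, 0, 0, 0, 0, 0, 0, 0, 0, 0, 0, 0, 0;
    0, 0, 0, 0, 0, 0, 1, 0, -2, 1, 0, 0, 0, 0, 0, 0, 0, 0, 0, 0, 0, 0, 0, 0;
    0, 0, 0, 0, 0, 0, 0, 1, 1, -2, 1, 0, 0, 0, 0, 0, 0, 0, 0, 0, 0, 0, 0, 0;
    0, 0, 0, 0, 0, 0, 0, 0, 0, 1, -2, 1, 0, 0, 0, 0, 0, 0, 0, 0, 0, 0, 0, 0;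
    0, 0, 0, 0, 0, 0, 0, 0, 0, 0, 1, -2, 1, 0, 0, 0, 0, 0, 0, 0, 0, 0, 0, 0;
    0, 0, 0, 0, 0, 0, 0, 0, 0, 0, 0, 1, -2, 1, 0, 0, 0, 0, 0, 0, 0, 0, 0, 0;
    0, 0, 0, 0, 0, 0, 0, 0, 0, 0, 0, 0, 1, -2, 0, 0, 0, 0, 0, 0, 0, 0, 0, 0;
    0, 0, 0, 0, 0, 0, 0, 0, 0, 0, 0, 0, 0, 0, -2, 0, 1, 0, 0, 0, 0, 0, 0, 0;
    0, 0, 0, 0, 0, 0, 0, 0, 0, 0, 0, 0, 0, 0, 0, -2, 0, 1, 0, 0, 0, 0, 0, 0;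
    0, 0, 0, 0, 0, 0, 0, 0, 0, 0, 0, 0, 0, 0, 1, 0, -2, 1, 0, 0, 0, 0, 0, 0;
    0, 0, 0, 0, 0, 0, 0, 0, 0, 0, 0, 0, 0, 0, 0, 1, 1, -2, 1, 0, 0, 0, 0, 0;
    0, 0, 0, 0, 0, 0, 0, 0, 0, 0, 0, 0, 0, 0, 0, 0, 0, 1, -2, 1, 0, 0, 0, 0;
    0, 0, 0, 0, 0, 0, 0, 0, 0, 0, 0, 0, 0, 0, 0, 0, 0, 0, 1, -2, 1, 0, 0, 0;
    0, 0, 0, 0, 0, 0, 0, 0, 0, 0, 0, 0, 0, 0, 0, 0, 0, 0, 0, 1, -2, 1, 0, 0;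
    0, 0, 0, 0, 0, 0, 0, 0, 0, 0, 0, 0, 0, 0, 0, 0, 0, 0, 0, 0, 1, -2, 0, 0;
    0, 0, 0, 0, 0, 0, 0, 0, 0, 0, 0, 0, 0, 0, 0, 0, 0, 0, 0, 0, 0, 0, -2, 1;
    0, 0, 0, 0, 0, 0, 0, 0, 0, 0, 0, 0, 0, 0, 0, 0, 0, 0, 0, 0, 0, 0, 1, -2]

/-- The bilinear form of the lattice `𝐋`. -/
def Bf (v w : Fin 24 → ℤ) : ℤ := v ⬝ᵥ (LGram *ᵥ w)

/-- An isometry of `𝐋` is a `ℤ`-linear automorphism preserving the bilinear form. -/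
def IsIsometry (g : (Fin 24 → ℤ) ≃ₗ[ℤ] (Fin 24 → ℤ)) : Prop :=
  ∀ v w, Bf (g v) (g w) = Bf v w

/-- The invariant sublattice `𝐋^g = {v ∈ 𝐋 : g v = v}`. -/
def invL (g : (Fin 24 → ℤ) ≃ₗ[ℤ] (Fin 24 → ℤ)) : Submodule ℤ (Fin 24 → ℤ) where
  carrier := {v | g v = v}
  add_mem' := by intro a b ha hb; simp only [Set.mem_setOf_eq, map_add] at *; rw [ha, hb]
  zero_mem' := by simp
  smul_mem' := by intro c a ha; simp only [Set.mem_setOf_eq, _root_.map_smul] at *; rw [ha]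

/-- The coinvariant sublattice `𝐋_g = {v ∈ 𝐋 : v·w = 0 for all w ∈ 𝐋^g}`. -/
def coinvL (g : (Fin 24 → ℤ) ≃ₗ[ℤ] (Fin 24 → ℤ)) : Submodule ℤ (Fin 24 → ℤ) where
  carrier := {v | ∀ w ∈ invL g, Bf v w = 0}
  add_mem' := by
    intro a b ha hb w hw
    simp only [Bf, add_dotProduct] at *
    rw [ha w hw, hb w hw, add_zero]
  zero_mem' := by intro w hw; simp [Bf]
  smul_mem' := by
    intro c a ha w hw
    simp only [Bf, smul_dotProduct] at *
    rw [ha w hw, smul_zero]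

/-- The divisibility of `v` in `𝐋` is `d`, i.e. `gcd {v·w : w ∈ 𝐋} = d`. -/
def HasDivisibility (v : Fin 24 → ℤ) (d : ℤ) : Prop :=
  (∀ w, d ∣ Bf v w) ∧ ∀ e : ℤ, (∀ w, e ∣ Bf v w) → e ∣ d

/-- The Gram matrix of `𝐋` over `ℚ`. -/
def QGram : Matrix (Fin 24) (Fin 24) ℚ := LGram.map (Int.cast)

/-- The bilinear form of `𝐋 ⊗ ℚ`. -/
def Bq (x y : Fin 24 → ℚ) : ℚ := x ⬝ᵥ (QGram *ᵥ y)

/-- The inclusion `𝐋 ⊆ 𝐋 ⊗ ℚ`. -/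
def intVec (w : Fin 24 → ℤ) : Fin 24 → ℚ := fun i => (w i : ℚ)

/-- `x ∈ 𝐋 ⊗ ℚ` lies in the dual lattice `𝐋^∨` iff it pairs integrally with `𝐋`. -/
def InDual (x : Fin 24 → ℚ) : Prop := ∀ w : Fin 24 → ℤ, ∃ n : ℤ, Bq x (intVec w) = (n : ℚ)

/-- `x ∈ 𝐋 ⊗ ℚ` lies in `𝐋` iff all its coordinates are integers. -/
def IsIntVec (x : Fin 24 → ℚ) : Prop := ∀ i, ∃ n : ℤ, x i = (n : ℚ)

/-- The matrix over `ℚ` of the rational extension of `g` to `𝐋 ⊗ ℚ`. -/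
def gQ (g : (Fin 24 → ℤ) ≃ₗ[ℤ] (Fin 24 → ℤ)) : Matrix (Fin 24) (Fin 24) ℚ :=
  (LinearMap.toMatrix' g.toLinearMap).map (Int.cast)

/-- `g` acts trivially on the discriminant group `𝐋^♯ = 𝐋^∨/𝐋`, i.e. the induced map
`g^♯` is the identity: `g(x) - x ∈ 𝐋` for every `x ∈ 𝐋^∨`. -/
def ActsTriviallyOnDisc (g : (Fin 24 → ℤ) ≃ₗ[ℤ] (Fin 24 → ℤ)) : Prop :=
  ∀ x : Fin 24 → ℚ, InDual x → IsIntVec (gQ g *ᵥ x - x)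


open MeasureTheory in
/-- pairwise-distance inequality -/
lemma blich_finite {n : ℕ} {ι : Type*} (s : Finset ι) (y : ι → (Fin n → ℝ))
    (h : ∀ i ∈ s, ∀ j ∈ s, i ≠ j → 6 ≤ (y i - y j) ⬝ᵥ (y i - y j)) :
    ∑ i ∈ s, (3 - y i ⬝ᵥ y i) ≤ 3 := by
  classical
  rcases s.eq_empty_or_nonempty with rfl | hs
  · simp
  have hk : (0:ℝ) < s.card := by exact_mod_cast hs.card_pos
  have e1 : ∑ i ∈ s, ∑ j ∈ s, (y i - y j) ⬝ᵥ (y i - y j)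
      = 2 * s.card * ∑ i ∈ s, y i ⬝ᵥ y i - 2 * ((∑ i ∈ s, y i) ⬝ᵥ (∑ i ∈ s, y i)) := by
    have : ∀ i j, (y i - y j) ⬝ᵥ (y i - y j) = y i ⬝ᵥ y i + y j ⬝ᵥ y j - 2 * (y i ⬝ᵥ y j) := by
      intro i j
      simp only [sub_dotProduct, dotProduct_sub, dotProduct_comm (y j) (y i)]
      ring
    simp_rw [this, Finset.sum_sub_distrib, Finset.sum_add_distrib, ← Finset.mul_sum,
      sum_dotProduct, dotProduct_sum, Finset.sum_const, nsmul_eq_mul, ← Finset.mul_sum]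
    ring
  have e2 : (s.card : ℝ) * (s.card - 1) * 6 ≤ ∑ i ∈ s, ∑ j ∈ s, (y i - y j) ⬝ᵥ (y i - y j) := by
    have : ∀ i ∈ s, ((s.card : ℝ) - 1) * 6 ≤ ∑ j ∈ s, (y i - y j) ⬝ᵥ (y i - y j) := by
      intro i hi
      rw [← Finset.add_sum_erase s _ hi]
      have := Finset.card_nsmul_le_sum (s.erase i) (fun j => (y i - y j) ⬝ᵥ (y i - y j)) 6
        (fun j hj => h i hi j (Finset.mem_of_mem_erase hj) (Finset.ne_of_mem_erase hj).symm)
      rw [Finset.card_erase_of_mem hi, nsmul_eq_mul, Nat.cast_sub hs.card_pos] at this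
      simpa using this
    have := Finset.card_nsmul_le_sum s _ _ this
    rw [nsmul_eq_mul] at this
    linarith
  have e3 : 0 ≤ (∑ i ∈ s, y i) ⬝ᵥ (∑ i ∈ s, y i) := by
    exact Finset.sum_nonneg fun i _ => mul_self_nonneg _
  have e4 : (s.card : ℝ) * (s.card - 1) * 6 ≤ 2 * s.card * ∑ i ∈ s, y i ⬝ᵥ y i := by linarith
  have e5 : ((s.card : ℝ) - 1) * 3 ≤ ∑ i ∈ s, y i ⬝ᵥ y i := by
    by_contra hc
    push Not at hc
    nlinarith
  rw [Finset.sum_sub_distrib, Finset.sum_const, nsmul_eq_mul]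
  linarith

open MeasureTheory in
lemma blich_vol {n : ℕ} (hn : 0 < n) (s : ℝ) :
    volume {y : Fin n → ℝ | y ⬝ᵥ y < s} =
      ENNReal.ofReal (√s ^ n * (√Real.pi ^ n / Real.Gamma (n / 2 + 1))) := by
  have : Nonempty (Fin n) := ⟨⟨0, hn⟩⟩
  have h := EuclideanSpace.volume_ball (Fin n) 0 (√s)
  rw [← (PiLp.volume_preserving_toLp (Fin n)).measure_preimage
      measurableSet_ball.nullMeasurableSet] at h
  rw [ENNReal.ofReal_mul (by positivity), ENNReal.ofReal_pow (by positivity)]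
  simp only [Fintype.card_fin] at h
  rw [← h]
  congr 1
  ext y
  simp only [Set.mem_preimage, mem_ball_zero_iff, EuclideanSpace.norm_eq, Set.mem_ofPred_eq]
  rw [Real.sqrt_lt_sqrt_iff (Finset.sum_nonneg fun i _ => by positivity)]
  simp [dotProduct, sq]

open MeasureTheory in
/-- Blichfeldt's bound on the minimum of a lattice. -/
lemma blichfeldt {n : ℕ} (hn : 0 < n) (B : Matrix (Fin n) (Fin n) ℝ) (hB : B.det ≠ 0)
    (hmin : ∀ z : Fin n → ℤ, z ≠ 0 →
      6 ≤ (B *ᵥ (fun i => (z i : ℝ))) ⬝ᵥ (B *ᵥ (fun i => (z i : ℝ)))) :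
    (3 * Real.pi) ^ n ≤ Real.Gamma (n / 2 + 2) ^ 2 * B.det ^ 2 := by
  set φ : (Fin n → ℝ) → ENNReal := fun x => ENNReal.ofReal (3 - (B *ᵥ x) ⬝ᵥ (B *ᵥ x)) with hφ
  have hcont : Continuous fun x : Fin n → ℝ => 3 - (B *ᵥ x) ⬝ᵥ (B *ᵥ x) := by fun_prop
  have hφm : Measurable φ := (ENNReal.continuous_ofReal.comp hcont).measurable
  let b := Pi.basisFun ℝ (Fin n)
  have hF := ZSpan.isAddFundamentalDomain b (volume : Measure (Fin n → ℝ))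
  have hvol : volume (ZSpan.fundamentalDomain b) = 1 := by
    rw [ZSpan.volume_fundamentalDomain]
    have : Matrix.of (b : Fin n → Fin n → ℝ) = 1 := by
      ext i j
      simp [b, Pi.basisFun_apply, Matrix.one_apply, Pi.single_apply, eq_comm]
    rw [this]; simp
  have up : ∫⁻ x, φ x ≤ 3 := by
    have : VAddInvariantMeasure (Submodule.span ℤ (Set.range b)) (Fin n → ℝ) volume :=
      ⟨fun c s _ => measure_preimage_add volume (c : Fin n → ℝ) s⟩
    rw [hF.lintegral_eq_tsum'', ← lintegral_tsum]
    swap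
    · intro g
      exact (hφm.comp (measurable_const_vadd g)).aemeasurable
    calc _ ≤ ∫⁻ x in ZSpan.fundamentalDomain b, 3 := by
          apply lintegral_mono
          intro x
          beta_reduce
          rw [ENNReal.tsum_eq_iSup_sum]
          apply iSup_le
          intro s
          classical
          let s' := s.filter fun g => (0:ℝ) ≤ (3:ℝ) - (B *ᵥ (g +ᵥ x)) ⬝ᵥ (B *ᵥ (g +ᵥ x))
          have e1 : ∑ g ∈ s, φ (g +ᵥ x) = ∑ g ∈ s', φ (g +ᵥ x) := by
            symm
            apply Finset.sum_subset (Finset.filter_subset _ _)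
            intro g hg hg'
            simp only [Finset.mem_filter, not_and, not_le] at hg'
            exact ENNReal.ofReal_of_nonpos (hg' hg).le
          rw [e1]
          simp only [hφ]
          rw [← ENNReal.ofReal_sum_of_nonneg]
          · rw [show (3:ENNReal) = ENNReal.ofReal 3 by simp]
            apply ENNReal.ofReal_le_ofReal
            apply blich_finite s' (fun g => B *ᵥ (g +ᵥ x))
            intro i _ j _ hij
            have hmem := (i - j).2
            rw [b.mem_span_iff_repr_mem ℤ] at hmem
            choose z hz using hmem
            have hz' : (fun k => (z k : ℝ)) = ((i - j : Submodule.span ℤ (Set.range b)) : Fin n → ℝ) := by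
              ext k
              have := hz k
              simpa [b] using this
            have hz0 : z ≠ 0 := by
              rintro rfl
              apply hij
              rw [← sub_eq_zero]
              ext1
              rw [← hz']
              ext k; simp
            have := hmin z hz0
            rw [hz'] at this
            rw [← Matrix.mulVec_sub]
            have e : (i +ᵥ x) - (j +ᵥ x) = ((i - j : Submodule.span ℤ (Set.range b)) : Fin n → ℝ) := by
              simp [Submodule.vadd_def]
            rw [e]; exact this
          · intro g hg
            exact (Finset.mem_filter.mp hg).2
      _ = 3 := by simp [hvol]
  have lo : ∫⁻ x, φ x = ENNReal.ofReal (|B.det|⁻¹ * (√Real.pi ^ n / Real.Gamma (n / 2 + 1)) *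
      ((3:ℝ) ^ ((n:ℝ)/2 + 1) / (n/2+1))) := by
    have h1 : ∀ x, φ x = ENNReal.ofReal (max 0 (3 - (B *ᵥ x) ⬝ᵥ (B *ᵥ x))) := by
      intro x
      simp [hφ, ENNReal.ofReal_max]
    simp_rw [h1]
    rw [lintegral_eq_lintegral_meas_lt (f := fun x => max 0 (3 - (B *ᵥ x) ⬝ᵥ (B *ᵥ x))) _ (Filter.Eventually.of_forall fun x => le_max_left _ _)
      ((continuous_const.max hcont).aemeasurable)]
    have h2 : ∀ t ∈ Set.Ioi (0:ℝ), volume {x | t < max 0 (3 - (B *ᵥ x) ⬝ᵥ (B *ᵥ x))} =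
        (Set.Ioc (0:ℝ) 3).indicator (fun t => ENNReal.ofReal (|B.det|⁻¹ *
          (√Real.pi ^ n / Real.Gamma (n / 2 + 1)) * (3 - t) ^ ((n:ℝ)/2))) t := by
      intro t ht
      have ht : 0 < t := ht
      have e1 : {x | t < max 0 (3 - (B *ᵥ x) ⬝ᵥ (B *ᵥ x))} =
        (Matrix.toLin' B) ⁻¹' {y | y ⬝ᵥ y < 3 - t} := by
        ext x
        simp only [Set.mem_ofPred_eq, Set.mem_preimage, Matrix.toLin'_apply, lt_max_iff]
        constructor
        · rintro (h | h) <;> linarith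
        · intro h; right; linarith
      by_cases ht3 : t ≤ 3
      · rw [Set.indicator_of_mem (show t ∈ Set.Ioc (0:ℝ) 3 from ⟨ht, ht3⟩), e1,
          Measure.addHaar_preimage_linearMap _ (by simpa using hB),
          blich_vol hn, ← ENNReal.ofReal_mul (by positivity)]
        congr 1
        rw [LinearMap.det_toLin', abs_inv, Real.sqrt_eq_rpow (3 - t), ← Real.rpow_natCast, ← Real.rpow_mul (by linarith)]
        rw [show (1/2 * (n:ℝ)) = n/2 by ring]
        ring
      · rw [Set.indicator_of_notMem (by simp; intro; linarith)]
        rw [e1]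
        convert measure_empty (μ := (volume : Measure (Fin n → ℝ)))
        ext x
        simp only [Set.mem_preimage, Set.mem_ofPred_eq, Set.mem_empty_iff_false, iff_false, not_lt]
        have : 0 ≤ (toLin' B x) ⬝ᵥ (toLin' B x) := Finset.sum_nonneg fun i _ => mul_self_nonneg _
        linarith
    rw [setLIntegral_congr_fun measurableSet_Ioi h2, lintegral_indicator measurableSet_Ioc,
      Measure.restrict_restrict measurableSet_Ioc,
      Set.inter_eq_left.mpr (fun x hx => hx.1), ← ofReal_integral_eq_lintegral_ofReal]
    · rw [← intervalIntegral.integral_of_le (by norm_num), intervalIntegral.integral_const_mul,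
        intervalIntegral.integral_comp_sub_left (fun s => s ^ ((n:ℝ)/2)) 3]
      rw [integral_rpow (Or.inl (by have : (0:ℝ) ≤ n := by positivity
                                    linarith))]
      rw [sub_self, sub_zero, Real.zero_rpow (by positivity), sub_zero]
    · have : IntervalIntegrable (fun t : ℝ => |B.det|⁻¹ * (√Real.pi ^ n / Real.Gamma (n / 2 + 1)) * (3 - t) ^ ((n:ℝ)/2)) volume 0 3 := by
        apply Continuous.intervalIntegrable
        have : Continuous fun s : ℝ => s ^ ((n:ℝ)/2) := Real.continuous_rpow_const (by positivity)
        exact continuous_const.mul (this.comp (by fun_prop))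
      exact (intervalIntegrable_iff_integrableOn_Ioc_of_le (by norm_num)).mp this
    · refine (ae_restrict_iff' measurableSet_Ioc).mpr (Filter.Eventually.of_forall fun t ht => ?_)
      have h3 : 0 ≤ 3 - t := by linarith [ht.2]
      have : 0 < Real.Gamma ((n:ℝ)/2 + 1) := Real.Gamma_pos_of_pos (by positivity)
      show 0 ≤ _
      positivity
  rw [lo, show (3:ENNReal) = ENNReal.ofReal 3 by simp, ENNReal.ofReal_le_ofReal_iff (by norm_num)] at up
  have hG : 0 < Real.Gamma ((n:ℝ)/2 + 1) := Real.Gamma_pos_of_pos (by positivity)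
  have hG2 : Real.Gamma ((n:ℝ)/2 + 2) = (n/2+1) * Real.Gamma (n/2+1) := by
    rw [← Real.Gamma_add_one (by positivity)]; congr 1; ring
  have hd : 0 < |B.det| := abs_pos.mpr hB
  have hp : (3:ℝ) ^ ((n:ℝ)/2 + 1) = √3 ^ n * 3 := by
    rw [Real.rpow_add (by norm_num), Real.rpow_one, Real.sqrt_eq_rpow, ← Real.rpow_natCast,
      ← Real.rpow_mul (by norm_num)]
    congr 2; ring
  rw [hp] at up
  have key : √Real.pi ^ n * √3 ^ n ≤ Real.Gamma (n/2+2) * |B.det| := by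
    rw [hG2]
    have hn2 : (0:ℝ) < n/2+1 := by positivity
    have e : |B.det|⁻¹ * (√Real.pi ^ n / Real.Gamma (n / 2 + 1)) * (√3 ^ n * 3 / (n/2+1)) =
      3 * ((√Real.pi ^ n * √3 ^ n) / ((n/2+1) * Real.Gamma (n/2+1) * |B.det|)) := by
      field_simp
    rw [e] at up
    have : (√Real.pi ^ n * √3 ^ n) / ((n/2+1) * Real.Gamma (n/2+1) * |B.det|) ≤ 1 := by linarith
    rwa [div_le_one (by positivity)] at this
  have := pow_le_pow_left₀ (by positivity) key 2
  rw [mul_pow, mul_pow, sq_abs, ← pow_mul, ← pow_mul, mul_comm n 2, pow_mul, pow_mul,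
    Real.sq_sqrt Real.pi_pos.le, Real.sq_sqrt (by norm_num), ← mul_pow, mul_comm Real.pi] at this
  exact this

lemma numeric (n : ℕ) (h2 : 2 ≤ n) (h24 : n ≤ 24) :
    Real.Gamma (n / 2 + 2) ^ 2 * (3 * 2 ^ (min n (24 - n)) : ℕ) < (3 * Real.pi) ^ n := by
  have hpi : (9.42:ℝ) ≤ 3 * Real.pi := by linarith [Real.pi_gt_d2]
  have hpi4 : Real.pi < 3.15 := Real.pi_lt_d2
  refine lt_of_lt_of_le ?_ (pow_le_pow_left₀ (by norm_num) hpi n)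
  rcases Nat.even_or_odd' n with ⟨k, rfl | rfl⟩
  · have : ((2 * k : ℕ) : ℝ) / 2 + 2 = (k + 1 : ℕ) + 1 := by push_cast; ring
    rw [this, Real.Gamma_nat_eq_factorial]
    have : k ≤ 12 := by omega
    have hk : 1 ≤ k := by omega
    clear h2
    interval_cases k <;> norm_num [Nat.factorial]
  · have : ((2 * k + 1 : ℕ) : ℝ) / 2 + 2 = (k + 2 : ℕ) + 1/2 := by push_cast; ring
    rw [this, Real.Gamma_nat_add_half, div_pow, mul_pow, Real.sq_sqrt Real.pi_pos.le]
    have : k ≤ 11 := by omega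
    have hk : 1 ≤ k := by omega
    clear h2
    interval_cases k <;> norm_num [Nat.doubleFactorial] <;> linarith

/-- An integral right inverse of `LGram` up to the coordinate 22. -/
def XMat : Matrix (Fin 24) (Fin 24) ℤ :=
  !![0, 1, 0, 0, 0, 0, 0, 0, 0, 0, 0, 0, 0, 0, 0, 0, 0, 0, 0, 0, 0, 0, 0, 0;
    1, 0, 0, 0, 0, 0, 0, 0, 0, 0, 0, 0, 0, 0, 0, 0, 0, 0, 0, 0, 0, 0, 0, 0;
    0, 0, 0, 1, 0, 0, 0, 0, 0, 0, 0, 0, 0, 0, 0, 0, 0, 0, 0, 0, 0, 0, 0, 0;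
    0, 0, 1, 0, 0, 0, 0, 0, 0, 0, 0, 0, 0, 0, 0, 0, 0, 0, 0, 0, 0, 0, 0, 0;
    0, 0, 0, 0, 0, 1, 0, 0, 0, 0, 0, 0, 0, 0, 0, 0, 0, 0, 0, 0, 0, 0, 0, 0;
    0, 0, 0, 0, 1, 0, 0, 0, 0, 0, 0, 0, 0, 0, 0, 0, 0, 0, 0, 0, 0, 0, 0, 0;
    0, 0, 0, 0, 0, 0, -4, -5, -7, -10, -8, -6, -4, -2, 0, 0, 0, 0, 0, 0, 0, 0, 0, 0;
    0, 0, 0, 0, 0, 0, -5, -8, -10, -15, -12, -9, -6, -3, 0, 0, 0, 0, 0, 0, 0, 0, 0, 0;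
    0, 0, 0, 0, 0, 0, -7, -10, -14, -20, -16, -12, -8, -4, 0, 0, 0, 0, 0, 0, 0, 0, 0, 0;
    0, 0, 0, 0, 0, 0, -10, -15, -20, -30, -24, -18, -12, -6, 0, 0, 0, 0, 0, 0, 0, 0, 0, 0;
    0, 0, 0, 0, 0, 0, -8, -12, -16, -24, -20, -15, -10, -5, 0, 0, 0, 0, 0, 0, 0, 0, 0, 0;
    0, 0, 0, 0, 0, 0, -6, -9, -12, -18, -15, -12, -8, -4, 0, 0, 0, 0, 0, 0, 0, 0, 0, 0;
    0, 0, 0, 0, 0, 0, -4, -6, -8, -12, -10, -8, -6, -3, 0, 0, 0, 0, 0, 0, 0, 0, 0, 0;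
    0, 0, 0, 0, 0, 0, -2, -3, -4, -6, -5, -4, -3, -2, 0, 0, 0, 0, 0, 0, 0, 0, 0, 0;
    0, 0, 0, 0, 0, 0, 0, 0, 0, 0, 0, 0, 0, 0, -4, -5, -7, -10, -8, -6, -4, -2, 0, 0;
    0, 0, 0, 0, 0, 0, 0, 0, 0, 0, 0, 0, 0, 0, -5, -8, -10, -15, -12, -9, -6, -3, 0, 0;
    0, 0, 0, 0, 0, 0, 0, 0, 0, 0, 0, 0, 0, 0, -7, -10, -14, -20, -16, -12, -8, -4, 0, 0;
    0, 0, 0, 0, 0, 0, 0, 0, 0, 0, 0, 0, 0, 0, -10, -15, -20, -30, -24, -18, -12, -6, 0, 0;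
    0, 0, 0, 0, 0, 0, 0, 0, 0, 0, 0, 0, 0, 0, -8, -12, -16, -24, -20, -15, -10, -5, 0, 0;
    0, 0, 0, 0, 0, 0, 0, 0, 0, 0, 0, 0, 0, 0, -6, -9, -12, -18, -15, -12, -8, -4, 0, 0;
    0, 0, 0, 0, 0, 0, 0, 0, 0, 0, 0, 0, 0, 0, -4, -6, -8, -12, -10, -8, -6, -3, 0, 0;
    0, 0, 0, 0, 0, 0, 0, 0, 0, 0, 0, 0, 0, 0, -2, -3, -4, -6, -5, -4, -3, -2, 0, 0;
    0, 0, 0, 0, 0, 0, 0, 0, 0, 0, 0, 0, 0, 0, 0, 0, 0, 0, 0, 0, 0, 0, 0, 1;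
    0, 0, 0, 0, 0, 0, 0, 0, 0, 0, 0, 0, 0, 0, 0, 0, 0, 0, 0, 0, 0, 0, 0, 0]

lemma LGram_symm : LGramᵀ = LGram := by decide +kernel

/-- Upper triangular half of `LGram`. -/
def THalf : Matrix (Fin 24) (Fin 24) ℤ :=
  Matrix.of fun i j => if i < j then LGram i j else if i = j then LGram i i / 2 else 0

lemma LGram_half : LGram = THalf + THalfᵀ := by decide +kernel

lemma LGram_X : LGram * XMat + Matrix.of (fun i j => if i = 22 then
    (if j = 22 then 1 else if j = 23 then 2 else 0) else 0) = 1 := by decide +kernel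

lemma LGram_u : LGram *ᵥ (Pi.single 22 (-2) + Pi.single 23 (-1)) = Pi.single 22 3 := by
  decide +kernel

lemma Bf_comm (v w) : Bf v w = Bf w v := by
  unfold Bf
  rw [dotProduct_comm, ← Matrix.vecMul_transpose, LGram_symm, ← dotProduct_mulVec]

lemma Bf_even (v) : ∃ k, Bf v v = 2 * k := by
  refine ⟨v ⬝ᵥ (THalf *ᵥ v), ?_⟩
  unfold Bf
  rw [LGram_half, add_mulVec, dotProduct_add, mulVec_transpose, dotProduct_comm v (v ᵥ* THalf),
    ← dotProduct_mulVec]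
  ring

lemma LGram_surj1 (y : Fin 24 → ℤ) : ∃ x, ∃ c : ℤ, y = LGram *ᵥ x + Pi.single 22 c := by
  refine ⟨XMat *ᵥ y, (y 22 + 2 * y 23), ?_⟩
  have h := congrArg (fun A => A *ᵥ y) LGram_X
  simp only [add_mulVec, one_mulVec, ← mulVec_mulVec] at h
  rw [← h]
  congr 1
  · rw [h]
  · rw [h]
    ext i
    simp only [mulVec, dotProduct, of_apply]
    by_cases hi : i = 22
    · subst hi
      simp only [if_true, Pi.single_eq_same]
      rw [Finset.sum_eq_add (22 : Fin 24) 23 (by decide)]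
      · simp
      · intro c _ hc
        simp [hc.1, hc.2]
      · simp
      · simp
    · simp [hi]

lemma LGram_surj (y : Fin 24 → ℤ) :
    ∃ x, ∃ j : Fin 3, y = LGram *ᵥ x + Pi.single 22 (j.val : ℤ) := by
  obtain ⟨x, c, h⟩ := LGram_surj1 y
  refine ⟨x + (c / 3) • (Pi.single 22 (-2) + Pi.single 23 (-1)), ⟨(c % 3).toNat, by omega⟩, ?_⟩
  rw [mulVec_add, mulVec_smul, LGram_u, h, add_assoc]
  congr 1
  have : ((c % 3).toNat : ℤ) = c % 3 := by omega
  simp only [this, ← Pi.single_smul, ← Pi.single_add]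
  congr 1
  have := Int.mul_ediv_add_emod c 3
  simp only [smul_eq_mul]
  omega

lemma LGram_three (y : Fin 24 → ℤ) : ∃ x, 3 • y = LGram *ᵥ x := by
  obtain ⟨x, c, h⟩ := LGram_surj1 y
  refine ⟨3 • x + c • (Pi.single 22 (-2) + Pi.single 23 (-1)), ?_⟩
  rw [mulVec_add, mulVec_smul, mulVec_smul, LGram_u, h, smul_add]
  congr 1
  ext i
  by_cases hi : i = 22
  · subst hi; simp [mul_comm]
  · simp [hi]

/-- pairing lemma: three times a coordinate is a value of the form -/
lemma Bf_coord (i : Fin 24) : ∃ x, ∀ v, Bf v x = 3 * v i := by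
  obtain ⟨x, hx⟩ := LGram_three (Pi.single i 1)
  refine ⟨x, fun v => ?_⟩
  unfold Bf
  rw [← hx, dotProduct_smul, dotProduct_single]
  simp

lemma Bf_nondeg (v) (h : ∀ w, Bf v w = 0) : v = 0 := by
  ext i
  obtain ⟨x, hx⟩ := Bf_coord i
  have := h x
  rw [hx] at this
  simpa using this

lemma Bf_add_left (u v w) : Bf (u + v) w = Bf u w + Bf v w := by simp [Bf, add_dotProduct]
lemma Bf_add_right (u v w) : Bf u (v + w) = Bf u v + Bf u w := by
  simp [Bf, mulVec_add, dotProduct_add]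
lemma Bf_smul_left (c : ℤ) (v w) : Bf (c • v) w = c * Bf v w := by
  unfold Bf
  rw [smul_dotProduct, smul_eq_mul]
lemma Bf_smul_right (c : ℤ) (v w) : Bf v (c • w) = c * Bf v w := by
  unfold Bf
  rw [mulVec_smul, dotProduct_smul, smul_eq_mul]
lemma Bf_neg_left (v w) : Bf (-v) w = - Bf v w := by simp [Bf]
lemma Bf_neg_right (v w) : Bf v (-w) = - Bf v w := by simp [Bf, mulVec_neg]
lemma Bf_sum_right {ι : Type*} (s : Finset ι) (v) (w : ι → (Fin 24 → ℤ)) :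
    Bf v (∑ i ∈ s, w i) = ∑ i ∈ s, Bf v (w i) := by
  simp [Bf, mulVec_sum, dotProduct_sum]
lemma Bf_sum_left {ι : Type*} (s : Finset ι) (v) (w : ι → (Fin 24 → ℤ)) :
    Bf (∑ i ∈ s, w i) v = ∑ i ∈ s, Bf (w i) v := by
  simp [Bf, sum_dotProduct]

lemma mem_coinv_iff (g : (Fin 24 → ℤ) ≃ₗ[ℤ] (Fin 24 → ℤ)) (hiso : IsIsometry g)
    (hg : ∀ x, g (g x) = x) (v) : v ∈ coinvL g ↔ g v = -v := by
  constructor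
  · intro hv
    have : v + g v = 0 := by
      apply Bf_nondeg
      intro w
      have h1 : Bf v (w + g w) = 0 := hv _ (by
        change g (w + g w) = w + g w
        rw [map_add, hg, add_comm])
      have h2 := hiso v (g w)
      rw [hg] at h2
      rw [Bf_add_left, h2, ← Bf_add_right]
      exact h1
    exact (neg_eq_of_add_eq_zero_right this).symm
  · intro hv w hw
    have hw : g w = w := hw
    have := hiso v w
    rw [hv, hw, Bf_neg_left] at this
    omega

/-- splitting of a lattice map -/
lemma exists_split (f : (Fin 24 → ℤ) →ₗ[ℤ] (Fin 24 → ℤ)) :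
    ∃ s : LinearMap.range f →ₗ[ℤ] (Fin 24 → ℤ), ∀ y, f (s y) = y := by
  obtain ⟨s, hs⟩ := Module.projective_lifting_property f.rangeRestrict LinearMap.id
    f.surjective_rangeRestrict
  refine ⟨s, fun y => ?_⟩
  have := congrArg (fun h => ((h y : LinearMap.range f) : Fin 24 → ℤ)) hs
  simpa using this

lemma exists_gens (f : (Fin 24 → ℤ) →ₗ[ℤ] (Fin 24 → ℤ)) :
    ∃ c : Fin (Module.finrank ℤ (LinearMap.range f)) → (Fin 24 → ℤ),
      ∀ x, ∃ m, f m = 0 ∧ ∃ a : Fin (Module.finrank ℤ (LinearMap.range f)) → ℤ,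
        x = m + ∑ l, a l • c l := by
  obtain ⟨s, hs⟩ := exists_split f
  let β := Module.finBasis ℤ (LinearMap.range f)
  refine ⟨fun l => s (β l), fun x => ⟨x - s (f.rangeRestrict x), ?_, β.repr (f.rangeRestrict x), ?_⟩⟩
  · rw [map_sub, hs]; simp
  · simp_rw [← map_smul, ← map_sum]
    rw [β.sum_repr, sub_add_cancel]

lemma exists_extend (f : (Fin 24 → ℤ) →ₗ[ℤ] (Fin 24 → ℤ)) (M : Submodule ℤ (Fin 24 → ℤ))
    (hM : ∀ v, v ∈ M ↔ f v = 0) (φ : M →ₗ[ℤ] ℤ) :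
    ∃ y : Fin 24 → ℤ, ∀ v : M, φ v = (v : Fin 24 → ℤ) ⬝ᵥ y := by
  obtain ⟨s, hs⟩ := exists_split f
  let p0 : (Fin 24 → ℤ) →ₗ[ℤ] (Fin 24 → ℤ) := LinearMap.id - s ∘ₗ f.rangeRestrict
  have hp0 : ∀ x, p0 x ∈ M := by
    intro x
    rw [hM]
    simp [p0, hs]
  let p : (Fin 24 → ℤ) →ₗ[ℤ] M := p0.codRestrict M hp0
  refine ⟨fun i => φ (p (Pi.single i 1)), fun v => ?_⟩
  have hv : p v = v := by
    ext1
    have : f.rangeRestrict (v : Fin 24 → ℤ) = 0 := by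
      ext1
      simpa using (hM v).mp v.2
    simp [p, p0, this]
  have e : (v : Fin 24 → ℤ) = ∑ i, (v : Fin 24 → ℤ) i • Pi.single i (1:ℤ) := by
    ext j
    simp [Finset.sum_apply, Pi.single_apply]
  conv_lhs => rw [← hv, e, map_sum, map_sum]
  simp only [map_smul, dotProduct, smul_eq_mul]

lemma det_bound (M K : Submodule ℤ (Fin 24 → ℤ)) (k r : ℕ) (c : Fin k → (Fin 24 → ℤ))
    (hMK : ∀ v ∈ M, ∀ w ∈ K, Bf v w = 0)
    (hc : ∀ x, ∃ m ∈ M, ∃ κ ∈ K, ∃ a : Fin k → ℤ, x = m + κ + ∑ l, a l • c l)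
    (h2 : ∀ x : Fin 24 → ℤ, ∃ m ∈ M, ∃ κ ∈ K, (2:ℤ) • x = m + κ)
    (hext : ∀ φ : M →ₗ[ℤ] ℤ, ∃ y : Fin 24 → ℤ, ∀ v : M, φ v = (v : Fin 24 → ℤ) ⬝ᵥ y)
    (b : Module.Basis (Fin r) ℤ M) (A : Matrix (Fin r) (Fin r) ℤ)
    (hA : ∀ i j, A i j = - Bf (b i) (b j)) (hdet : A.det ≠ 0) :
    A.det.natAbs ≤ 3 * 2 ^ k := by
  have hinj : Function.Injective A.mulVecLin := by
    rw [← LinearMap.ker_eq_bot, Matrix.ker_mulVecLin_eq_bot_iff]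
    intro v hv
    by_contra hv0
    exact hdet (Matrix.exists_mulVec_eq_zero_iff.mp ⟨v, hv0, hv⟩)
  set N := LinearMap.range A.mulVecLin with hN
  have hcard : A.det.natAbs = Nat.card ((Fin r → ℤ) ⧸ N) := by
    have := Submodule.natAbs_det_equiv N (LinearEquiv.ofInjective A.mulVecLin hinj)
    rw [← this, ← LinearMap.det_toLin']
    rfl
  rw [hcard]
  let F : Fin 3 × (Fin k → Fin 2) → (Fin r → ℤ) ⧸ N := fun q =>
    N.mkQ (fun i => (q.1.val : ℤ) * (b i : Fin 24 → ℤ) 22 + Bf (b i) (∑ l, ((q.2 l).val : ℤ) • c l))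
  have hF : Function.Surjective F := by
    intro ψ
    obtain ⟨φ, rfl⟩ := N.mkQ_surjective ψ
    obtain ⟨y, hy⟩ := hext (b.constr ℤ φ)
    obtain ⟨x, j, rfl⟩ := LGram_surj y
    obtain ⟨m, hm, κ, hκ, a, ha⟩ := hc x
    obtain ⟨m', hm', κ', hκ', hs⟩ := h2 (∑ l, (a l / 2) • c l)
    refine ⟨(j, fun l => ⟨(a l % 2).toNat, by omega⟩), ?_⟩
    have e1 : ∀ l, (((a l % 2).toNat : ℕ) : ℤ) = a l % 2 := fun l => by omega
    have hx : x = (m + m') + (κ + κ') + ∑ l, (a l % 2) • c l := by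
      have : ∑ l, a l • c l = (2:ℤ) • (∑ l, (a l / 2) • c l) + ∑ l, (a l % 2) • c l := by
        rw [Finset.smul_sum, ← Finset.sum_add_distrib]
        refine Finset.sum_congr rfl fun l _ => ?_
        rw [smul_smul, ← add_smul, Int.mul_ediv_add_emod]
      rw [ha, this, hs]
      abel
    simp only [F, e1]
    rw [← sub_eq_zero, ← map_sub, Submodule.mkQ_apply, Submodule.Quotient.mk_eq_zero]
    refine ⟨b.repr ⟨m + m', M.add_mem hm hm'⟩, ?_⟩
    have e2 : m + m' = ∑ l, b.repr ⟨m + m', M.add_mem hm hm'⟩ l • (b l : Fin 24 → ℤ) := by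
      have := congrArg (fun t : M => (t : Fin 24 → ℤ)) (b.sum_repr ⟨m + m', M.add_mem hm hm'⟩)
      simp only [Submodule.coe_sum, Submodule.coe_smul] at this
      exact this.symm
    ext i
    have e3 : φ i = Bf (b i) x + j.val * (b i : Fin 24 → ℤ) 22 := by
      have := hy (b i)
      rw [b.constr_basis, dotProduct_add, dotProduct_single] at this
      rw [this, mul_comm]
      rfl
    have e4 : Bf (b i) (m + m') = - (A *ᵥ (b.repr ⟨m + m', M.add_mem hm hm'⟩)) i := by
      conv_lhs => rw [e2]
      rw [Bf_sum_right, mulVec, dotProduct, ← Finset.sum_neg_distrib]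
      refine Finset.sum_congr rfl fun l _ => ?_
      rw [Bf_smul_right, hA]; ring
    have e5 : Bf (b i) (κ + κ') = 0 := hMK _ (b i).2 _ (K.add_mem hκ hκ')
    rw [hx, Bf_add_right, Bf_add_right, e4, e5] at e3
    simp only [mulVecLin_apply, Pi.sub_apply, e3]
    ring
  have := Nat.card_le_card_of_surjective F hF
  simpa using this

lemma psd_of_int {r : ℕ} (A : Matrix (Fin r) (Fin r) ℤ)
    (hpos : ∀ z : Fin r → ℤ, 0 ≤ z ⬝ᵥ (A *ᵥ z)) (x : Fin r → ℝ) :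
    0 ≤ x ⬝ᵥ ((A.map (Int.cast : ℤ → ℝ)) *ᵥ x) := by
  set AR := A.map (Int.cast : ℤ → ℝ) with hAR
  have hcast : ∀ z : Fin r → ℤ, (0:ℝ) ≤ (fun i => (z i : ℝ)) ⬝ᵥ (AR *ᵥ (fun i => (z i : ℝ))) := by
    intro z
    have : (fun i => (z i : ℝ)) ⬝ᵥ (AR *ᵥ (fun i => (z i : ℝ))) = ((z ⬝ᵥ (A *ᵥ z) : ℤ) : ℝ) := by
      simp [dotProduct, mulVec, hAR]
    rw [this]
    exact_mod_cast hpos z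
  have hc : Continuous fun x : Fin r → ℝ => x ⬝ᵥ (AR *ᵥ x) := by fun_prop
  have hlim : Filter.Tendsto (fun n : ℕ => (fun i => (⌊(n:ℝ) * x i⌋ : ℝ) / n : Fin r → ℝ))
      Filter.atTop (nhds x) := by
    rw [tendsto_pi_nhds]
    intro i
    have h0 : Filter.Tendsto (fun n : ℕ => x i - 1 / (n:ℝ)) Filter.atTop (nhds (x i)) := by
      simpa using tendsto_const_nhds.sub (tendsto_one_div_atTop_nhds_zero_nat (𝕜 := ℝ))
    refine tendsto_of_tendsto_of_tendsto_of_le_of_le' h0 tendsto_const_nhds ?_ ?_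
    · filter_upwards [Filter.eventually_gt_atTop 0] with n hn
      have hn : (0:ℝ) < n := by exact_mod_cast hn
      rw [le_div_iff₀ hn, sub_mul, div_mul_cancel₀ _ hn.ne']
      linarith [Int.lt_floor_add_one ((n:ℝ) * x i)]
    · filter_upwards [Filter.eventually_gt_atTop 0] with n hn
      have hn : (0:ℝ) < n := by exact_mod_cast hn
      rw [div_le_iff₀ hn]
      linarith [Int.floor_le ((n:ℝ) * x i)]
  refine ge_of_tendsto ((hc.tendsto x).comp hlim) (Filter.Eventually.of_forall fun n => ?_)
  have e : (fun i => (⌊(n:ℝ) * x i⌋ : ℝ) / n : Fin r → ℝ) =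
      (n:ℝ)⁻¹ • (fun i => ((⌊(n:ℝ) * x i⌋ : ℤ) : ℝ)) := by
    ext i; simp [div_eq_inv_mul]
  simp only [Function.comp]
  rw [e, mulVec_smul, smul_dotProduct, dotProduct_smul]
  have := hcast (fun i => ⌊(n:ℝ) * x i⌋)
  simp only [smul_eq_mul]
  positivity

open scoped MatrixOrder in
lemma exists_sqrt {r : ℕ} (A : Matrix (Fin r) (Fin r) ℝ) (hs : Aᵀ = A)
    (hpos : ∀ x : Fin r → ℝ, 0 ≤ x ⬝ᵥ (A *ᵥ x)) : ∃ B : Matrix (Fin r) (Fin r) ℝ, A = Bᵀ * B := by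
  have hA : A.PosSemidef := .of_dotProduct_mulVec_nonneg (by
    rw [IsHermitian, conjTranspose_eq_transpose_of_trivial, hs]) (by simpa using hpos)
  obtain ⟨B, hB⟩ := CStarAlgebra.nonneg_iff_eq_star_mul_self.mp hA.nonneg
  exact ⟨B, by rw [hB, star_eq_conjTranspose, conjTranspose_eq_transpose_of_trivial]⟩

/-- Combination: an integral form of minimum at least 6 and rank at least 2 has big determinant. -/
lemma no_form {r : ℕ} (h2 : 2 ≤ r) (h24 : r ≤ 24) (A : Matrix (Fin r) (Fin r) ℤ) (hs : Aᵀ = A)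
    (hmin : ∀ z : Fin r → ℤ, z ≠ 0 → 6 ≤ z ⬝ᵥ (A *ᵥ z))
    (hdet : A.det.natAbs ≤ 3 * 2 ^ (min r (24 - r))) : False := by
  have hpos : ∀ z : Fin r → ℤ, 0 ≤ z ⬝ᵥ (A *ᵥ z) := by
    intro z
    by_cases hz : z = 0
    · simp [hz]
    · linarith [hmin z hz]
  have hd0 : A.det ≠ 0 := by
    intro h0
    obtain ⟨z, hz, hz'⟩ := Matrix.exists_mulVec_eq_zero_iff.mpr h0
    have := hmin z hz
    rw [hz'] at this
    simp at this
  set AR := A.map (Int.cast : ℤ → ℝ) with hAR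
  have hARs : ARᵀ = AR := by rw [hAR, ← transpose_map, hs]
  obtain ⟨B, hB⟩ := exists_sqrt AR hARs (psd_of_int A hpos)
  have hdB : B.det ^ 2 = (A.det : ℝ) := by
    have h1 : AR.det = (A.det : ℝ) := by
      have := (Int.castRingHom ℝ).map_det A
      simpa [hAR] using this.symm
    rw [← h1, hB, det_mul, det_transpose, sq]
  have hB0 : B.det ≠ 0 := by
    intro h0
    rw [h0] at hdB
    apply hd0
    have : (A.det : ℝ) = 0 := by rw [← hdB]; simp
    exact_mod_cast this
  have := blichfeldt (by omega) B hB0 (by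
    intro z hz
    have e : (B *ᵥ (fun i => (z i : ℝ))) ⬝ᵥ (B *ᵥ (fun i => (z i : ℝ))) =
        ((z ⬝ᵥ (A *ᵥ z) : ℤ) : ℝ) := by
      rw [dotProduct_mulVec, ← mulVec_transpose, mulVec_mulVec, ← hB, dotProduct_comm]
      simp [dotProduct, mulVec, hAR]
    rw [e]
    exact_mod_cast hmin z hz)
  have hn := numeric r h2 h24
  have hle : B.det ^ 2 ≤ ((3 * 2 ^ (min r (24 - r)) : ℕ) : ℝ) := by
    rw [hdB]
    have : A.det ≤ ((3 * 2 ^ (min r (24 - r)) : ℕ) : ℤ) := by omega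
    exact_mod_cast this
  have := mul_le_mul_of_nonneg_left hle (sq_nonneg (Real.Gamma ((r:ℝ)/2 + 2)))
  linarith

/-- There is no isometry of order `2` of `𝐋 = 3U ⊕ 2E8 ⊕ A2` acting non-trivially on the
discriminant group `𝐋^♯` whose coinvariant sublattice is negative definite and contains no
vector of square `-2`, no vector of square `-4`, and no vector `v` of square `-6` with
divisibility `(v,𝐋) = 3`. -/
theorem stmt2 (g : (Fin 24 → ℤ) ≃ₗ[ℤ] (Fin 24 → ℤ)) (hiso : IsIsometry g)
    (hord : orderOf g = 2)
    (hnontriv : ¬ ActsTriviallyOnDisc g)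
    (hneg : ∀ v ∈ coinvL g, v ≠ 0 → Bf v v < 0)
    (h2 : ∀ v ∈ coinvL g, Bf v v ≠ -2)
    (h4 : ∀ v ∈ coinvL g, Bf v v ≠ -4)
    (h6 : ∀ v ∈ coinvL g, ¬ (Bf v v = -6 ∧ HasDivisibility v 3)) :
    False := by
  have hg : ∀ x, g (g x) = x := by
    intro x
    have h := pow_orderOf_eq_one g
    rw [hord, sq] at h
    exact congrArg (fun f : (Fin 24 → ℤ) ≃ₗ[ℤ] (Fin 24 → ℤ) => f x) h
  have hM := mem_coinv_iff g hiso hg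
  set M := coinvL g with hMdef
  have h6le : ∀ v ∈ M, v ≠ 0 → 6 ≤ - Bf v v := by
    intro v hv hv0
    have a1 := hneg v hv hv0
    have a2 := h2 v hv
    have a3 := h4 v hv
    obtain ⟨k, hk⟩ := Bf_even v
    omega
  let fp : (Fin 24 → ℤ) →ₗ[ℤ] (Fin 24 → ℤ) := LinearMap.id + g.toLinearMap
  let fm : (Fin 24 → ℤ) →ₗ[ℤ] (Fin 24 → ℤ) := LinearMap.id - g.toLinearMap
  have hfp : ∀ v, v ∈ M ↔ fp v = 0 := by
    intro v
    rw [hM]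
    simp only [fp, LinearMap.add_apply, LinearMap.id_apply, LinearEquiv.coe_coe]
    rw [add_comm, add_eq_zero_iff_eq_neg]
  have hfm : ∀ v, v ∈ invL g ↔ fm v = 0 := by
    intro v
    simp only [fm, LinearMap.sub_apply, LinearMap.id_apply, LinearEquiv.coe_coe, sub_eq_zero]
    exact eq_comm
  have hmemM : ∀ x, x - g x ∈ M := fun x => by rw [hM, map_sub, hg]; abel
  have hmemK : ∀ x, x + g x ∈ invL g := fun x => by
    change g (x + g x) = x + g x
    rw [map_add, hg]; abel
  have hdouble : ∀ x : Fin 24 → ℤ, ∃ m ∈ M, ∃ κ ∈ invL g, (2:ℤ) • x = m + κ := fun x =>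
    ⟨x - g x, hmemM x, x + g x, hmemK x, by rw [two_smul]; abel⟩
  obtain ⟨r, hr⟩ : ∃ r, r = Module.finrank ℤ M := ⟨_, rfl⟩
  let b : Module.Basis (Fin r) ℤ M := Module.finBasisOfFinrankEq ℤ M hr.symm
  let A : Matrix (Fin r) (Fin r) ℤ := Matrix.of fun i j => - Bf (b i) (b j)
  have hAs : Aᵀ = A := by
    ext i j
    simp [A, Bf_comm (b j) (b i)]
  have hAq : ∀ z : Fin r → ℤ, z ⬝ᵥ (A *ᵥ z) =
      - Bf (∑ i, z i • (b i : Fin 24 → ℤ)) (∑ i, z i • (b i : Fin 24 → ℤ)) := by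
    intro z
    simp only [dotProduct, mulVec, A, of_apply, Bf_sum_left, Bf_sum_right, Bf_smul_left,
      Bf_smul_right, ← Finset.sum_neg_distrib, Finset.mul_sum]
    refine Finset.sum_congr rfl fun i _ => Finset.sum_congr rfl fun j _ => ?_
    rw [Bf_comm (b j) (b i)]
    ring
  have hmin : ∀ z : Fin r → ℤ, z ≠ 0 → 6 ≤ z ⬝ᵥ (A *ᵥ z) := by
    intro z hz
    rw [hAq]
    apply h6le
    · exact M.sum_mem fun i _ => M.smul_mem _ (b i).2
    · intro h0
      apply hz
      have h0' : ∑ i, z i • b i = 0 := by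
        ext1
        simpa using h0
      ext i
      exact Fintype.linearIndependent_iff.mp b.linearIndependent z h0' i
  have hd0 : A.det ≠ 0 := by
    intro h0
    obtain ⟨z, hz, hz'⟩ := Matrix.exists_mulVec_eq_zero_iff.mpr h0
    have := hmin z hz
    rw [hz'] at this
    simp at this
  have hext := exists_extend fp M hfp
  have hMK : ∀ v ∈ M, ∀ w ∈ invL g, Bf v w = 0 := fun v hv w hw => hv w hw
  have hker : LinearMap.ker fp = M := by
    ext v
    rw [LinearMap.mem_ker, hfp]
  have hrk := (LinearMap.ker fp).finrank_quotient_add_finrank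
  rw [fp.quotKerEquivRange.finrank_eq, hker, ← hr, Module.finrank_fin_fun] at hrk
  have b1 : A.det.natAbs ≤ 3 * 2 ^ (24 - r) := by
    obtain ⟨c, hc⟩ := exists_gens fp
    have := det_bound M (invL g) _ r c hMK (by
      intro x
      obtain ⟨m, hm, a, ha⟩ := hc x
      exact ⟨m, (hfp m).mpr hm, 0, Submodule.zero_mem _, a, by rw [add_zero]; exact ha⟩)
      hdouble hext b A (fun i j => rfl) hd0
    rwa [show Module.finrank ℤ (LinearMap.range fp) = 24 - r by omega] at this
  have b2 : A.det.natAbs ≤ 3 * 2 ^ r := by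
    obtain ⟨c, hc⟩ := exists_gens fm
    have := det_bound M (invL g) _ r c hMK (by
      intro x
      obtain ⟨m, hm, a, ha⟩ := hc x
      exact ⟨0, Submodule.zero_mem _, m, (hfm m).mpr hm, a, by rw [zero_add]; exact ha⟩)
      hdouble hext b A (fun i j => rfl) hd0
    refine this.trans ?_
    have hle : LinearMap.range fm ≤ M := by
      rintro _ ⟨x, rfl⟩
      exact hmemM x
    have : Module.finrank ℤ (LinearMap.range fm) ≤ r := by
      rw [hr]
      exact Submodule.finrank_mono hle
    gcongr
    norm_num
  have hr24 : r ≤ 24 := by omega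
  have hbd : A.det.natAbs ≤ 3 * 2 ^ (min r (24 - r)) := by
    rcases le_total r (24 - r) with h | h
    · rwa [min_eq_left h]
    · rwa [min_eq_right h]
  rcases Nat.lt_or_ge r 2 with hlt | hge
  swap
  · exact no_form hge hr24 A hAs hmin hbd
  interval_cases r
  · -- rank zero
    have hg1 : g = 1 := by
      apply LinearEquiv.ext
      intro x
      have h0 : (⟨x - g x, hmemM x⟩ : M) = 0 := by
        rw [← b.sum_repr ⟨x - g x, hmemM x⟩]
        simp
      have := congrArg (fun t : M => (t : Fin 24 → ℤ)) h0
      simp only [Submodule.coe_zero, sub_eq_zero] at this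
      exact this.symm
    rw [hg1, orderOf_one] at hord
    omega
  · -- rank one
    obtain ⟨v, hv⟩ : ∃ v : Fin 24 → ℤ, v = b 0 := ⟨_, rfl⟩
    have hvM : v ∈ M := hv ▸ (b 0).2
    have hv0 : v ≠ 0 := by
      rw [hv]
      intro h
      exact b.ne_zero 0 (Subtype.ext h)
    have hdA : A.det = - Bf v v := by
      rw [det_fin_one, hv]; rfl
    have hv6 : Bf v v = -6 := by
      have := h6le v hvM hv0
      rw [hdA] at b2
      omega
    refine h6 v hvM ⟨hv6, ?_, ?_⟩
    · intro w
      have e : w - g w = b.repr ⟨w - g w, hmemM w⟩ 0 • v := by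
        have := congrArg (fun t : M => (t : Fin 24 → ℤ)) (b.sum_repr ⟨w - g w, hmemM w⟩)
        simp at this
        rw [hv]
        simpa using this.symm
      have e1 : Bf v (w - g w) = 2 * Bf v w := by
        have h1 := hiso v w
        rw [(hM v).mp hvM, Bf_neg_left] at h1
        rw [sub_eq_add_neg, Bf_add_right, Bf_neg_right, h1]
        ring
      rw [e, Bf_smul_right, hv6] at e1
      omega
    · intro e he
      have hodd : ¬ (2 : ℤ) ∣ e := by
        intro h2e
        have : ∀ i, (2:ℤ) ∣ v i := by
          intro i
          obtain ⟨x, hx⟩ := Bf_coord i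
          have := h2e.trans (he x)
          rw [hx] at this
          omega
        choose u hu using this
        have hu' : v = (2:ℤ) • u := by
          ext i
          simp [hu i]
        rw [hu', Bf_smul_left, Bf_smul_right] at hv6
        omega
      have h6e : e ∣ 2 * 3 := by
        have := he v
        rw [hv6] at this
        simpa using this
      have hcop : IsCoprime e 2 := by
        rw [isCoprime_comm]
        exact (Int.prime_two.coprime_iff_not_dvd).mpr hodd
      exact hcop.dvd_of_dvd_mul_left h6e
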